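/- Let Ψ be a monotonic expansion system that is proper at every order w.r.t. every element of S_0, and endow S_0 with the order topology of its linear order. If the set S_0^{[<∞]} of elements of finite order (those y with y_n = ν_n for some n) is densely ordered in S_0 (between any two distinct elements of S_0 there lies an element of S_0^{[<∞]}), then Ψ is accurate: for every y ∈ S_0 the convergents y^{[n]} converge to y in the order topology. -/

import Mathlib

/-- An *expansion system* `Ψ`: element spaces `S i` with neutral elements `ν i`,
coefficient spaces `C i`, projections `P i : S i → C i` and expansions
`E i : S i → S (i+1)` such that `E i (ν i) = ν (i+1)` and each combined map
`F i = (P i, E i) : S i → C i × S (i+1)` is injective. -/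
structure ExpansionSystem where
  S : ℕ → Type*
  C : ℕ → Type*
  ν : ∀ i, S i
  P : ∀ i, S i → C i
  E : ∀ i, S i → S (i + 1)
  E_ν : ∀ i, E i (ν i) = ν (i + 1)
  F_inj : ∀ i, Function.Injective (fun y : S i => (P i y, E i y))

namespace ExpansionSystem

variable (Ψ : ExpansionSystem)

/-- `iter Ψ i y` is the element `y_i`: `y_0 = y`, `y_{i+1} = E i y_i`. -/
def iter : ∀ i : ℕ, Ψ.S 0 → Ψ.S i
  | 0, y => y
  | (i + 1), y => Ψ.E i (iter i y)

/-- The `i`-th coefficient `P̂_i y = P i (y_i)`. -/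
def coeff (i : ℕ) (y : Ψ.S 0) : Ψ.C i := Ψ.P i (Ψ.iter i y)

/-- The coefficient map `P̂ : S 0 → ∏ i, C i`. -/
def coeffMap (y : Ψ.S 0) : ∀ i, Ψ.C i := fun i => Ψ.coeff i y

/-- `a` records the backward recursion defining the `n`-th convergent of `y`:
`a n = ν n` and, for `i < n`, `F i (a i) = (P̂_i y, a (i+1))`, i.e.
`a i = F i ⁻¹ (P̂_i y, a (i+1))`; in particular at each step the pair
`(P̂_i y, a (i+1))` lies in the image of `F i`. -/
def IsChain (n : ℕ) (y : Ψ.S 0) (a : ∀ i, Ψ.S i) : Prop :=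
  a n = Ψ.ν n ∧ ∀ i < n, Ψ.P i (a i) = Ψ.coeff i y ∧ Ψ.E i (a i) = a (i + 1)

/-- `Ψ` is *proper at order `n` w.r.t. `y`*: the backward recursion
`y_n^[n] = ν n`, `y_i^[n] = F i ⁻¹ (P̂_i y, y_{i+1}^[n])` is well defined. -/
def ProperAt (n : ℕ) (y : Ψ.S 0) : Prop := ∃ a, Ψ.IsChain n y a

/-- `z` is the `n`-th convergent `y^[n]` of `y` (the outcome `y_0^[n]` of the
backward recursion). -/
def IsConvergent (n : ℕ) (y z : Ψ.S 0) : Prop := ∃ a, Ψ.IsChain n y a ∧ a 0 = z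

end ExpansionSystem

namespace ExpansionSystem

variable (Ψ : ExpansionSystem) [∀ i, LinearOrder (Ψ.S i)] [∀ i, LinearOrder (Ψ.C i)]

/-- `F i = (P i, E i)` is strictly increasing w.r.t. the dictionary order on
`C i × S (i+1)`: for `y < y'` one has `P i y ≤ P i y'`, and `E i y < E i y'`
whenever `P i y = P i y'`. -/
def FIncreasingAt (i : ℕ) : Prop :=
  ∀ y y' : Ψ.S i, y < y' →
    Ψ.P i y ≤ Ψ.P i y' ∧ (Ψ.P i y = Ψ.P i y' → Ψ.E i y < Ψ.E i y')

/-- `F i = (P i, E i)` is strictly decreasing w.r.t. the dictionary order on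
`C i × S (i+1)`. -/
def FDecreasingAt (i : ℕ) : Prop :=
  ∀ y y' : Ψ.S i, y < y' →
    Ψ.P i y' ≤ Ψ.P i y ∧ (Ψ.P i y = Ψ.P i y' → Ψ.E i y' < Ψ.E i y)

/-- `Ψ` is a strictly increasing expansion system. -/
def StrictlyIncreasingES : Prop := ∀ i, Ψ.FIncreasingAt i

/-- `Ψ` is a monotonic expansion system: each `F i` is strictly monotone
(strictly increasing or strictly decreasing) w.r.t. the dictionary order. -/
def MonotonicES : Prop := ∀ i, Ψ.FIncreasingAt i ∨ Ψ.FDecreasingAt i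

/-- The dictionary (lexicographic) strict order on coefficient sequences: two
distinct sequences are compared at the first index where they differ. -/
def lexLt (a b : ∀ i, Ψ.C i) : Prop :=
  ∃ k, (∀ i < k, a i = b i) ∧ a k < b k

end ExpansionSystem

namespace ExpansionSystem

/-- Along a chain, the iterates of its initial element are the entries of the chain. -/
lemma IsChain.iter_eq {Ψ : ExpansionSystem} {n : ℕ} {y : Ψ.S 0} {a : ∀ i, Ψ.S i}
    (h : Ψ.IsChain n y a) : ∀ i ≤ n, Ψ.iter i (a 0) = a i
  | 0, _ => rfl
  | i + 1, hi => by
    rw [iter, h.iter_eq i (by omega), (h.2 i hi).2]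

lemma IsConvergent.iter_eq {Ψ : ExpansionSystem} {n : ℕ} {y z : Ψ.S 0}
    (h : Ψ.IsConvergent n y z) : Ψ.iter n z = Ψ.ν n := by
  obtain ⟨a, ha, rfl⟩ := h
  rw [ha.iter_eq n le_rfl, ha.1]

lemma IsConvergent.coeff_eq {Ψ : ExpansionSystem} {n : ℕ} {y z : Ψ.S 0}
    (h : Ψ.IsConvergent n y z) {i : ℕ} (hi : i < n) : Ψ.coeff i z = Ψ.coeff i y := by
  obtain ⟨a, ha, rfl⟩ := h
  rw [coeff, ha.iter_eq i hi.le, (ha.2 i hi).1]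

lemma iter_eq_ν_of_le {Ψ : ExpansionSystem} {m n : ℕ} {z : Ψ.S 0} (hmn : m ≤ n)
    (h : Ψ.iter m z = Ψ.ν m) : Ψ.iter n z = Ψ.ν n := by
  induction n, hmn using Nat.le_induction with
  | base => exact h
  | succ n _ ih => rw [iter, ih, Ψ.E_ν]

variable {Ψ : ExpansionSystem} [∀ i, LinearOrder (Ψ.S i)] [∀ i, LinearOrder (Ψ.C i)]

/-- Expansion maps preserve strict betweenness when the endpoints have the same projection. -/
lemma MonotonicES.expansion_between (hmono : Ψ.MonotonicES) {i : ℕ} {x z y : Ψ.S i}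
    (hP : Ψ.P i x = Ψ.P i y) (h : (x < z ∧ z < y) ∨ (y < z ∧ z < x)) :
    (Ψ.E i x < Ψ.E i z ∧ Ψ.E i z < Ψ.E i y) ∨ (Ψ.E i y < Ψ.E i z ∧ Ψ.E i z < Ψ.E i x) := by
  wlog hxy : x < z ∧ z < y generalizing x y
  · exact (this hP.symm h.symm (h.resolve_left hxy)).symm
  rcases hmono i with hF | hF
  · obtain ⟨h₁, h₂⟩ := hF x z hxy.1
    obtain ⟨h₃, h₄⟩ := hF z y hxy.2
    have hxz : Ψ.P i x = Ψ.P i z := le_antisymm h₁ (hP ▸ h₃)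
    exact Or.inl ⟨h₂ hxz, h₄ (hxz.symm.trans hP)⟩
  · obtain ⟨h₁, h₂⟩ := hF x z hxy.1
    obtain ⟨h₃, h₄⟩ := hF z y hxy.2
    have hxz : Ψ.P i x = Ψ.P i z := le_antisymm (hP ▸ h₃) h₁
    exact Or.inr ⟨h₄ (hxz.symm.trans hP), h₂ hxz⟩

lemma MonotonicES.iter_between (hmono : Ψ.MonotonicES) {x z y : Ψ.S 0}
    (h : (x < z ∧ z < y) ∨ (y < z ∧ z < x)) :
    ∀ n, (∀ i < n, Ψ.coeff i x = Ψ.coeff i y) →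
      (Ψ.iter n x < Ψ.iter n z ∧ Ψ.iter n z < Ψ.iter n y) ∨
        (Ψ.iter n y < Ψ.iter n z ∧ Ψ.iter n z < Ψ.iter n x)
  | 0, _ => h
  | n + 1, hc => hmono.expansion_between (hc n n.lt_succ_self)
      (hmono.iter_between h n fun i hi => hc i (hi.trans n.lt_succ_self))

/-- An element of order at most `n` does not lie strictly between `y` and its `n`-th convergent. -/
lemma MonotonicES.not_between_convergent (hmono : Ψ.MonotonicES) {n : ℕ} {x z y : Ψ.S 0}
    (hx : Ψ.IsConvergent n y x) (hz : Ψ.iter n z = Ψ.ν n) :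
    ¬((x < z ∧ z < y) ∨ (y < z ∧ z < x)) := by
  intro h
  have hb := hmono.iter_between h n fun i hi => hx.coeff_eq hi
  rw [hx.iter_eq, hz] at hb
  exact hb.elim (fun h => lt_irrefl _ h.1) (fun h => lt_irrefl _ h.2)

end ExpansionSystem

/-- let `Ψ` be a monotonic expansion system, proper at every order
w.r.t. every element, with `S 0` carrying the order topology of its linear order.
If the set of elements of finite order is densely ordered in `S 0`, then `Ψ` is
accurate: for every `y`, the convergents `y^[n]` converge to `y` in the order
topology. -/
theorem stmt14 (Ψ : ExpansionSystem) [∀ i, LinearOrder (Ψ.S i)] [∀ i, LinearOrder (Ψ.C i)]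
    (hmono : Ψ.MonotonicES)
    (hproper : ∀ (y : Ψ.S 0) (n : ℕ), Ψ.ProperAt n y)
    (hdense : ∀ y y' : Ψ.S 0, y < y' →
      ∃ z : Ψ.S 0, (∃ n, Ψ.iter n z = Ψ.ν n) ∧ y < z ∧ z < y') :
    ∀ (y : Ψ.S 0) (c : ℕ → Ψ.S 0), (∀ n, Ψ.IsConvergent n y (c n)) →
      Filter.Tendsto c Filter.atTop (@nhds _ (Preorder.topology (Ψ.S 0)) y) := by
  intro y c hc
  let _ : TopologicalSpace (Ψ.S 0) := Preorder.topology (Ψ.S 0)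
  have : OrderTopology (Ψ.S 0) := ⟨rfl⟩
  refine tendsto_order.2 ⟨fun a ha => ?_, fun b hb => ?_⟩
  · obtain ⟨z, ⟨m, hm⟩, haz, hzy⟩ := hdense a y ha
    filter_upwards [Filter.eventually_ge_atTop m] with n hn
    refine haz.trans_le (not_lt.1 fun hlt => ?_)
    exact hmono.not_between_convergent (hc n) (ExpansionSystem.iter_eq_ν_of_le hn hm)
      (Or.inl ⟨hlt, hzy⟩)
  · obtain ⟨z, ⟨m, hm⟩, hyz, hzb⟩ := hdense y b hb
    filter_upwards [Filter.eventually_ge_atTop m] with n hn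
    refine lt_of_le_of_lt (not_lt.1 fun hlt => ?_) hzb
    exact hmono.not_between_convergent (hc n) (ExpansionSystem.iter_eq_ν_of_le hn hm)
      (Or.inr ⟨hyz, hlt⟩)
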